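/- Let μ, ζ be real constants, and let u : ℝ²×[0,∞) → ℝ², ρ, p : ℝ²×[0,∞) → ℝ, F : ℝ²×[0,∞) → ℝ² be smooth, with ρ everywhere positive, satisfying the 2D momentum equation ρ(∂_t u + (u·∇)u) = μΔu − ∇(p − ζφ) + ρF on ℝ²×(0,∞), where φ = ∇·u. Then the expansion rate φ satisfies on ℝ²×(0,∞): ∂_t φ = Σ_i ∂_i( ((μ+ζ)/ρ) ∂_i φ ) − (u·∇)φ − ∇(1/ρ)·( ∇p + μ ∇∧ω ) + ω² − Σ_{i,j}(∂_j u^i)² − (1/ρ)Δp + ∇·F, where ω = ∂_1 u² − ∂_2 u¹ is the scalar vorticity and ∇∧ω = (∂_2 ω, −∂_1 ω). -/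

import Mathlib

noncomputable section

/-- Spatial partial derivative in the `j`-th coordinate direction on `ℝ²`. -/
def pd (j : Fin 2) (f : (Fin 2 → ℝ) → ℝ) (x : Fin 2 → ℝ) : ℝ :=
  fderiv ℝ f x (Pi.single j 1)

/-- The scalar vorticity `ω(x,t) = ∂₁u²(x,t) − ∂₂u¹(x,t)`. -/
def vort (u : (Fin 2 → ℝ) → ℝ → Fin 2 → ℝ) (x : Fin 2 → ℝ) (t : ℝ) : ℝ :=
  pd 0 (fun y => u y t 1) x - pd 1 (fun y => u y t 0) x

/-- The expansion rate `φ(x,t) = ∂₁u¹(x,t) + ∂₂u²(x,t)`. -/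
def expR (u : (Fin 2 → ℝ) → ℝ → Fin 2 → ℝ) (x : Fin 2 → ℝ) (t : ℝ) : ℝ :=
  pd 0 (fun y => u y t 0) x + pd 1 (fun y => u y t 1) x

theorem two_le_top' : (2 : WithTop ℕ∞) ≤ ((⊤ : ℕ∞) : WithTop ℕ∞) :=
  WithTop.coe_le_coe.2 (le_top : (2 : ℕ∞) ≤ ⊤)

@[fun_prop]
theorem ContDiff.pd {f : (Fin 2 → ℝ) → ℝ} (hf : ContDiff ℝ (⊤ : ℕ∞) f) (j : Fin 2) : ContDiff ℝ (⊤ : ℕ∞) (pd j f) := by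
  have h : ContDiff ℝ (⊤ : ℕ∞) (fderiv ℝ f) := hf.fderiv_right (by simp)
  exact h.clm_apply contDiff_const

theorem ContDiff.da {f : (Fin 2 → ℝ) → ℝ} (hf : ContDiff ℝ (⊤ : ℕ∞) f) (x : Fin 2 → ℝ) : DifferentiableAt ℝ f x :=
  (hf.differentiable (by simp)) x

theorem pd_add' {f g : (Fin 2 → ℝ) → ℝ} (hf : ContDiff ℝ (⊤ : ℕ∞) f) (hg : ContDiff ℝ (⊤ : ℕ∞) g) (j : Fin 2) :
    pd j (fun y => f y + g y) = fun y => pd j f y + pd j g y := by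
  funext x
  simp only [pd]
  rw [fderiv_fun_add (hf.da x) (hg.da x)]
  rfl

theorem pd_sub' {f g : (Fin 2 → ℝ) → ℝ} (hf : ContDiff ℝ (⊤ : ℕ∞) f) (hg : ContDiff ℝ (⊤ : ℕ∞) g) (j : Fin 2) :
    pd j (fun y => f y - g y) = fun y => pd j f y - pd j g y := by
  funext x
  simp only [pd]
  rw [fderiv_fun_sub (hf.da x) (hg.da x)]
  rfl

theorem pd_mul' {f g : (Fin 2 → ℝ) → ℝ} (hf : ContDiff ℝ (⊤ : ℕ∞) f) (hg : ContDiff ℝ (⊤ : ℕ∞) g) (j : Fin 2) :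
    pd j (fun y => f y * g y) = fun y => f y * pd j g y + g y * pd j f y := by
  funext x
  simp only [pd]
  rw [fderiv_fun_mul (hf.da x) (hg.da x)]
  rfl

theorem pd_const' (c : ℝ) (j : Fin 2) : pd j (fun _ => c) = fun _ => 0 := by
  funext x
  simp [pd]

theorem pd_cmul' {f : (Fin 2 → ℝ) → ℝ} (hf : ContDiff ℝ (⊤ : ℕ∞) f) (c : ℝ) (j : Fin 2) :
    pd j (fun y => c * f y) = fun y => c * pd j f y := by
  rw [pd_mul' contDiff_const hf, pd_const']
  simp

theorem pd_comm' {f : (Fin 2 → ℝ) → ℝ} (hf : ContDiff ℝ (⊤ : ℕ∞) f) (i j : Fin 2) :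
    pd i (pd j f) = pd j (pd i f) := by
  funext x
  have h : ContDiff ℝ (⊤ : ℕ∞) (fderiv ℝ f) := hf.fderiv_right (by simp)
  have hd : DifferentiableAt ℝ (fderiv ℝ f) x := (h.differentiable (by simp)) x
  have key : ∀ a b : Fin 2, pd a (pd b f) x
      = fderiv ℝ (fderiv ℝ f) x (Pi.single a 1) (Pi.single b 1) := by
    intro a b
    have : pd b f = fun y => fderiv ℝ f y (Pi.single b 1) := rfl
    rw [this]
    simp only [pd]
    rw [fderiv_clm_apply hd (differentiableAt_const _)]
    simp
  rw [key, key]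
  have hs : IsSymmSndFDerivAt ℝ f x :=
    (hf.contDiffAt (x := x)).isSymmSndFDerivAt (by simpa using two_le_top')
  exact hs _ _

/-- Spatial identity. -/
theorem spatial (μ ζ : ℝ) (a b r p F0 F1 : (Fin 2 → ℝ) → ℝ) (ha : ContDiff ℝ (⊤ : ℕ∞) a) (hb : ContDiff ℝ (⊤ : ℕ∞) b)
    (hr : ContDiff ℝ (⊤ : ℕ∞) r) (hp : ContDiff ℝ (⊤ : ℕ∞) p) (hF0 : ContDiff ℝ (⊤ : ℕ∞) F0) (hF1 : ContDiff ℝ (⊤ : ℕ∞) F1) (x : Fin 2 → ℝ) :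
    pd 0 (fun y => r y * (μ * (pd 0 (pd 0 a) y + pd 1 (pd 1 a) y)
        - pd 0 (fun z => p z - ζ * (pd 0 a z + pd 1 b z)) y) + F0 y
        - (a y * pd 0 a y + b y * pd 1 a y)) x
    + pd 1 (fun y => r y * (μ * (pd 0 (pd 0 b) y + pd 1 (pd 1 b) y)
        - pd 1 (fun z => p z - ζ * (pd 0 a z + pd 1 b z)) y) + F1 y
        - (a y * pd 0 b y + b y * pd 1 b y)) x
    = (pd 0 (fun y => ((μ + ζ) * r y) * pd 0 (fun z => pd 0 a z + pd 1 b z) y) x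
      + pd 1 (fun y => ((μ + ζ) * r y) * pd 1 (fun z => pd 0 a z + pd 1 b z) y) x)
      - (a x * pd 0 (fun z => pd 0 a z + pd 1 b z) x
        + b x * pd 1 (fun z => pd 0 a z + pd 1 b z) x)
      - (pd 0 r x * (pd 0 p x + μ * pd 1 (fun z => pd 0 b z - pd 1 a z) x)
        + pd 1 r x * (pd 1 p x + μ * (-pd 0 (fun z => pd 0 b z - pd 1 a z) x)))
      + (pd 0 b x - pd 1 a x) ^ 2
      - ((pd 0 a x ^ 2 + pd 1 a x ^ 2) + (pd 0 b x ^ 2 + pd 1 b x ^ 2))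
      - r x * (pd 0 (pd 0 p) x + pd 1 (pd 1 p) x)
      + (pd 0 F0 x + pd 1 F1 x) := by
  have a0 := ha.pd 0
  have a1 := ha.pd 1
  have b0 := hb.pd 0
  have b1 := hb.pd 1
  have a00 := a0.pd 0
  have a11 := a1.pd 1
  have a01 := a1.pd 0
  have b00 := b0.pd 0
  have b11 := b1.pd 1
  have b01 := b1.pd 0
  have p0 := hp.pd 0
  have p1 := hp.pd 1
  have ca := pd_comm' ha 1 0
  have cb := pd_comm' hb 1 0
  have ca0 := pd_comm' a0 1 0
  have ca1 := pd_comm' a1 1 0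
  have cb0 := pd_comm' b0 1 0
  have cb1 := pd_comm' b1 1 0
  simp (disch := fun_prop) only [pd_add', pd_sub', pd_cmul', pd_mul', ca, cb]
  simp only [cb, ca1, cb0]
  ring

theorem half_nhds {x : Fin 2 → ℝ} {t : ℝ} (ht : 0 < t) :
    {q : (Fin 2 → ℝ) × ℝ | 0 ≤ q.2} ∈ nhds (x, t) := by
  have : ∀ᶠ q : (Fin 2 → ℝ) × ℝ in nhds (x, t), 0 < q.2 :=
    continuousAt_snd.eventually (lt_mem_nhds ht)
  filter_upwards [this] with q hq using le_of_lt hq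

theorem slice {g : (Fin 2 → ℝ) → ℝ → ℝ}
    (hg : ContDiffOn ℝ (⊤ : ℕ∞) (fun q : (Fin 2 → ℝ) × ℝ => g q.1 q.2) {q | 0 ≤ q.2})
    {t : ℝ} (ht : 0 < t) : ContDiff ℝ (⊤ : ℕ∞) (fun y => g y t) := by
  rw [contDiff_iff_contDiffAt]
  intro x
  have h := hg.contDiffAt (half_nhds (x := x) ht)
  exact h.comp x (f := fun y : Fin 2 → ℝ => (y, t)) (by fun_prop)

theorem swap {g : (Fin 2 → ℝ) → ℝ → ℝ}
    (hg : ContDiffOn ℝ (⊤ : ℕ∞) (fun q : (Fin 2 → ℝ) × ℝ => g q.1 q.2) {q | 0 ≤ q.2})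
    {t : ℝ} (ht : 0 < t) (x : Fin 2 → ℝ) (j : Fin 2) :
    HasDerivAt (fun s => pd j (fun y => g y s) x)
      (pd j (fun y => deriv (fun s => g y s) t) x) t := by
  set G : (Fin 2 → ℝ) × ℝ → ℝ := fun q => g q.1 q.2 with hG
  have hc : ∀ y s, 0 < s → ContDiffAt ℝ (⊤ : ℕ∞) G (y, s) :=
    fun y s hs => hg.contDiffAt (half_nhds hs)
  have hd : ∀ y s, 0 < s → HasFDerivAt G (fderiv ℝ G (y, s)) (y, s) :=
    fun y s hs => ((hc y s hs).differentiableAt (by simp)).hasFDerivAt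
  have e1 : ∀ y s, 0 < s → pd j (fun y => g y s) y = fderiv ℝ G (y, s) (Pi.single j 1, 0) := by
    intro y s hs
    have h := HasFDerivAt.comp (f := fun e : Fin 2 → ℝ => (e, s)) y (hd y s hs) (hasFDerivAt_prodMk_left (𝕜 := ℝ) y s)
    have h' : fderiv ℝ (fun y => g y s) y = _ := h.fderiv
    rw [pd, h']
    simp
  have e2 : ∀ y, deriv (fun s => g y s) t = fderiv ℝ G (y, t) (0, 1) := by
    intro y
    have h := (hd y t ht).comp t (hasFDerivAt_prodMk_right y t)
    have h' : deriv (fun s => g y s) t = _ := h.hasDerivAt.deriv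
    rw [h']
    simp
  have hc2 : DifferentiableAt ℝ (fderiv ℝ G) (x, t) :=
    ((hc x t ht).fderiv_right (m := 1) (by rw [one_add_one_eq_two]; exact two_le_top')).differentiableAt (by simp)
  have hs : IsSymmSndFDerivAt ℝ G (x, t) :=
    (hc x t ht).isSymmSndFDerivAt (by simpa using two_le_top')
  have h1 := (hc2.hasFDerivAt.comp t (hasFDerivAt_prodMk_right x t)).clm_apply
    (hasFDerivAt_const ((Pi.single j 1, 0) : (Fin 2 → ℝ) × ℝ) t)
  have h2 := (HasFDerivAt.comp (f := fun e : Fin 2 → ℝ => (e, t)) x hc2.hasFDerivAt (hasFDerivAt_prodMk_left x t)).clm_apply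
    (hasFDerivAt_const ((0, 1) : (Fin 2 → ℝ) × ℝ) x)
  have e3 : pd j (fun y => deriv (fun s => g y s) t) x
      = fderiv ℝ (fderiv ℝ G) (x, t) (Pi.single j 1, 0) (0, 1) := by
    have : (fun y => deriv (fun s => g y s) t) = fun y => fderiv ℝ G (y, t) (0, 1) := funext e2
    rw [this, pd]
    have h' : fderiv ℝ (fun y => fderiv ℝ G (y, t) (0, 1)) x = _ := h2.fderiv
    rw [h']
    simp
  rw [e3, hs.eq]
  have h3 : HasDerivAt (fun s => fderiv ℝ G (x, s) (Pi.single j 1, 0))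
      (fderiv ℝ (fderiv ℝ G) (x, t) (0, 1) (Pi.single j 1, 0)) t := by
    have := h1.hasDerivAt
    simpa using this
  refine h3.congr_of_eventuallyEq ?_
  filter_upwards [lt_mem_nhds ht] with s hs' using e1 x s hs'

/-- The 2D expansion-rate equation for a viscous compressible fluid flow:
`∂_t φ = Σ_i ∂_i(((μ+ζ)/ρ)∂_i φ) − (u·∇)φ − ∇(1/ρ)·(∇p + μ∇∧ω)
  + ω² − |∇u|² − (1/ρ)Δp + ∇·F`, where `∇∧ω = (∂₂ω, −∂₁ω)`. -/
theorem statement_13 (μ ζ : ℝ) (u : (Fin 2 → ℝ) → ℝ → Fin 2 → ℝ)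
    (ρ pr : (Fin 2 → ℝ) → ℝ → ℝ) (F : (Fin 2 → ℝ) → ℝ → Fin 2 → ℝ)
    (hu : ContDiffOn ℝ (⊤ : ℕ∞) (fun q : (Fin 2 → ℝ) × ℝ => u q.1 q.2) {q | 0 ≤ q.2})
    (hρ : ContDiffOn ℝ (⊤ : ℕ∞) (fun q : (Fin 2 → ℝ) × ℝ => ρ q.1 q.2) {q | 0 ≤ q.2})
    (hpr : ContDiffOn ℝ (⊤ : ℕ∞) (fun q : (Fin 2 → ℝ) × ℝ => pr q.1 q.2) {q | 0 ≤ q.2})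
    (hF : ContDiffOn ℝ (⊤ : ℕ∞) (fun q : (Fin 2 → ℝ) × ℝ => F q.1 q.2) {q | 0 ≤ q.2})
    (hpos : ∀ x t, 0 ≤ t → 0 < ρ x t)
    (hmom : ∀ (x : Fin 2 → ℝ) (t : ℝ), 0 < t → ∀ i,
      ρ x t * (deriv (fun s => u x s i) t + ∑ j, u x t j * pd j (fun y => u y t i) x)
        = μ * (∑ j, pd j (pd j (fun y => u y t i)) x)
          - pd i (fun y => pr y t - ζ * expR u y t) x + ρ x t * F x t i) :
    ∀ (x : Fin 2 → ℝ) (t : ℝ), 0 < t →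
      deriv (fun s => expR u x s) t
        = (∑ i, pd i (fun y => ((μ + ζ) / ρ y t) * pd i (fun z => expR u z t) y) x)
          - (∑ j, u x t j * pd j (fun y => expR u y t) x)
          - (pd 0 (fun y => (ρ y t)⁻¹) x *
              (pd 0 (fun y => pr y t) x + μ * pd 1 (fun y => vort u y t) x)
            + pd 1 (fun y => (ρ y t)⁻¹) x *
              (pd 1 (fun y => pr y t) x + μ * (-pd 0 (fun y => vort u y t) x)))
          + (vort u x t) ^ 2
          - (∑ i, ∑ j, (pd j (fun y => u y t i) x) ^ 2)
          - (ρ x t)⁻¹ * (∑ i, pd i (pd i (fun y => pr y t)) x)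
          + (∑ i, pd i (fun y => F y t i) x) := by
  intro x t ht
  have hui : ∀ i, ContDiffOn ℝ (⊤ : ℕ∞) (fun q : (Fin 2 → ℝ) × ℝ => u q.1 q.2 i)
      {q | 0 ≤ q.2} := fun i => contDiffOn_pi.1 hu i
  have hFi : ∀ i, ContDiffOn ℝ (⊤ : ℕ∞) (fun q : (Fin 2 → ℝ) × ℝ => F q.1 q.2 i)
      {q | 0 ≤ q.2} := fun i => contDiffOn_pi.1 hF i
  have sa := slice (g := fun y s => u y s 0) (hui 0) ht
  have sb := slice (g := fun y s => u y s 1) (hui 1) ht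
  have sF0 := slice (g := fun y s => F y s 0) (hFi 0) ht
  have sF1 := slice (g := fun y s => F y s 1) (hFi 1) ht
  have sp := slice hpr ht
  have sρ := slice hρ ht
  have hne : ∀ y, ρ y t ≠ 0 := fun y => (hpos y t ht.le).ne'
  have sr : ContDiff ℝ (⊤ : ℕ∞) (fun y => (ρ y t)⁻¹) := sρ.inv hne
  have hdt : deriv (fun s => expR u x s) t
      = pd 0 (fun y => deriv (fun s => u y s 0) t) x
        + pd 1 (fun y => deriv (fun s => u y s 1) t) x :=
    ((swap (g := fun y s => u y s 0) (hui 0) ht x 0).add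
      (swap (g := fun y s => u y s 1) (hui 1) ht x 1)).deriv
  have hD : ∀ i y, deriv (fun s => u y s i) t
      = (ρ y t)⁻¹ * (μ * (∑ j, pd j (pd j (fun y => u y t i)) y)
          - pd i (fun y => pr y t - ζ * expR u y t) y) + F y t i
        - ∑ j, u y t j * pd j (fun y => u y t i) y := by
    intro i y
    have h := hmom y t ht i
    have h0 := hne y
    field_simp
    linear_combination h
  rw [hdt, funext (hD 0), funext (hD 1)]
  simp only [Fin.sum_univ_two]
  have hs := spatial μ ζ _ _ _ _ _ _ sa sb sr sp sF0 sF1 x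
  simp only [div_eq_mul_inv]
  exact hs
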